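/- Assume (A1) with ε ∈ (0,1) and (A5), let d_0 = inf_{x ∉ C} W_0(x), and suppose φ_0(d_0) > b_0. Then for every λ with 0 < λ < 1 − b_0/φ_0(d_0), the kernel Ǩ defined by Ǩ(x,x'; A×A') = P(x,A)P(x',A') for (x,x') ∉ C×C and Ǩ(x,x'; A×A') = Q(x,A)Q(x',A') for (x,x') ∈ C×C satisfies the bivariate drift condition (A4) with W(x,x') = W_0(x) + W_0(x') − 1 and φ = λφ_0; that is, (ǨW)(x,x') ≤ W(x,x') − λ·φ_0(W(x,x')) for all (x,x') ∉ C×C, and moreover sup_{(x,x')∈C×C} (ǨW)(x,x') ≤ 2(1−ε)^{-1}( sup_C PW_0 − ε ν(W_0) ) − 1. -/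

import Mathlib

open MeasureTheory ProbabilityTheory Filter Set
open scoped ENNReal NNReal

noncomputable section

variable {X : Type*} [MeasurableSpace X]

/-- `φ ∈ 𝒞`: concave, differentiable on `[1,∞)` with derivative `φ'`, positive,
`φ(1) > 0`, `φ(v) → ∞` and `φ'(v) → 0` as `v → ∞`. -/
structure MemC (φ φ' : ℝ → ℝ) : Prop where
  concave : ConcaveOn ℝ (Set.Ici 1) φ
  pos : ∀ v ∈ Set.Ici (1 : ℝ), 0 < φ v
  hasDeriv : ∀ v ∈ Set.Ici (1 : ℝ), HasDerivWithinAt φ (φ' v) (Set.Ici 1) v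
  tendsto_atTop : Tendsto φ atTop atTop
  deriv_tendsto_zero : Tendsto φ' atTop (nhds 0)

theorem MemC.mono_aux {φ φ' : ℝ → ℝ} (h : MemC φ φ') {u v : ℝ} (hu : 1 ≤ u) (huv : u ≤ v) :
    φ u ≤ φ v := by
  obtain ⟨w, hw1, hw2⟩ :=
    ((h.tendsto_atTop.eventually_ge_atTop (φ u)).and (eventually_ge_atTop v)).exists
  have hm := h.concave.min_le_of_mem_Icc (x := u) (y := w) (z := v) hu
    (le_trans hu (huv.trans hw2) : (1:ℝ) ≤ w) ⟨huv, hw2⟩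
  rwa [min_eq_left hw1] at hm

theorem MemC.sub_aux {φ φ' : ℝ → ℝ} (h : MemC φ φ') {u v : ℝ} (hu : 1 ≤ u) (hv : 1 ≤ v) :
    φ (u + v - 1) ≤ φ u + φ v := by
  have h1 : 0 < φ 1 := h.pos 1 (by simp)
  by_cases hs : u = 1
  · subst hs
    have : (1:ℝ) + v - 1 = v := by ring
    rw [this]; linarith
  have hu' : 1 < u := lt_of_le_of_ne hu (Ne.symm hs)
  have hd : 0 < u + v - 2 := by linarith
  have hmem : u + v - 1 ∈ Set.Ici (1:ℝ) := by simp only [Set.mem_Ici]; linarith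
  have hone : (1:ℝ) ∈ Set.Ici (1:ℝ) := by simp
  have ha : 0 ≤ (u - 1) / (u + v - 2) := div_nonneg (by linarith) hd.le
  have hb : 0 ≤ (v - 1) / (u + v - 2) := div_nonneg (by linarith) hd.le
  have hab : (u - 1) / (u + v - 2) + (v - 1) / (u + v - 2) = 1 := by
    rw [← add_div, div_eq_one_iff_eq hd.ne']; ring
  have c1 := h.concave.2 hmem hone ha hb hab
  have c2 := h.concave.2 hmem hone hb ha (by rw [add_comm]; exact hab)
  have e1 : (u - 1) / (u + v - 2) * (u + v - 1) + (v - 1) / (u + v - 2) * 1 = u := by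
    field_simp; ring
  have e2 : (v - 1) / (u + v - 2) * (u + v - 1) + (u - 1) / (u + v - 2) * 1 = v := by
    field_simp; ring
  simp only [smul_eq_mul] at c1 c2
  rw [e1] at c1
  rw [e2] at c2
  generalize (u - 1) / (u + v - 2) = a at *
  generalize (v - 1) / (u + v - 2) = b at *
  have hb' : b = 1 - a := by linarith
  subst hb'
  nlinarith

theorem lint_aux (μ μ' : Measure X) [IsProbabilityMeasure μ] [IsProbabilityMeasure μ']
    (W₀ : X → ℝ) (hm : Measurable W₀) (h1 : ∀ x, 1 ≤ W₀ x) :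
    ∫⁻ z : X × X, ENNReal.ofReal (W₀ z.1 + W₀ z.2 - 1) ∂(μ.prod μ') + 1 =
      ∫⁻ y, ENNReal.ofReal (W₀ y) ∂μ + ∫⁻ y, ENNReal.ofReal (W₀ y) ∂μ' := by
  have m1 : Measurable fun y => ENNReal.ofReal (W₀ y) := hm.ennreal_ofReal
  have f1 : Measurable fun z : X × X => ENNReal.ofReal (W₀ z.1) := m1.comp measurable_fst
  have f2 : Measurable fun z : X × X => ENNReal.ofReal (W₀ z.2) := m1.comp measurable_snd
  have k1 : ∫⁻ z : X × X, ENNReal.ofReal (W₀ z.1) ∂(μ.prod μ') = ∫⁻ y, ENNReal.ofReal (W₀ y) ∂μ := by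
    rw [lintegral_prod _ f1.aemeasurable]; simp
  have k2 : ∫⁻ z : X × X, ENNReal.ofReal (W₀ z.2) ∂(μ.prod μ') = ∫⁻ y, ENNReal.ofReal (W₀ y) ∂μ' := by
    rw [lintegral_prod _ f2.aemeasurable]; simp
  have k3 : ∫⁻ _ : X × X, (1 : ℝ≥0∞) ∂(μ.prod μ') = 1 := by simp
  rw [← k1, ← k2, ← lintegral_add_left f1]
  conv_lhs => enter [2]; rw [← k3]
  rw [← lintegral_add_right _ measurable_const]
  refine lintegral_congr fun z => ?_
  have a := h1 z.1
  have b := h1 z.2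
  rw [← ENNReal.ofReal_one, ← ENNReal.ofReal_add (by linarith) zero_le_one,
    ← ENNReal.ofReal_add (by linarith) (by linarith)]
  congr 1; ring

theorem one_le_aux (μ : Measure X) [IsProbabilityMeasure μ]
    (W₀ : X → ℝ) (h1 : ∀ x, 1 ≤ W₀ x) : 1 ≤ ∫⁻ y, ENNReal.ofReal (W₀ y) ∂μ := by
  have k3 : ∫⁻ _ : X, (1 : ℝ≥0∞) ∂μ = 1 := by simp
  rw [← k3]
  exact lintegral_mono fun x => by simpa using h1 x

/-- under (A1) with `ε ∈ (0,1)` and the univariate drift condition (A5),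
if `φ₀(d₀) > b₀` with `d₀ = inf_{x ∉ C} W₀(x)`, then for every `0 < λ < 1 - b₀/φ₀(d₀)` the
product coupling kernel `Ǩ` (independent `P`-moves off `C×C`, independent `Q`-moves on `C×C`)
satisfies (A4) with `W(x,x') = W₀(x) + W₀(x') - 1` and `φ = λφ₀`, and
`sup_{C×C} ǨW ≤ 2(1-ε)^{-1}(sup_C PW₀ - ε ν(W₀)) - 1`. -/
theorem stmt7
    -- (A1): small set C with minorising constant ε ∈ (0,1) and measure ν
    (P Q : Kernel X X) [IsMarkovKernel P] [IsMarkovKernel Q]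
    (C : Set X) (hC : MeasurableSet C)
    (ε : ℝ) (hε0 : 0 < ε) (hε1 : ε < 1)
    (ν : Measure X) [IsProbabilityMeasure ν]
    (hminor : ∀ x ∈ C, ∀ A : Set X, MeasurableSet A → ENNReal.ofReal ε * ν A ≤ P x A)
    -- Q is the residual kernel on C
    (hres : ∀ x ∈ C, ∀ A : Set X, MeasurableSet A →
      P x A = ENNReal.ofReal ε * ν A + ENNReal.ofReal (1 - ε) * Q x A)
    -- (A5): univariate drift condition with φ₀ ∈ 𝒞 and constant b₀
    (φ₀ φ₀' : ℝ → ℝ) (hφ₀ : MemC φ₀ φ₀') (b₀ : ℝ) (hb₀ : 0 ≤ b₀)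
    (W₀ : X → ℝ) (hW₀meas : Measurable W₀) (hW₀1 : ∀ x, 1 ≤ W₀ x)
    (hdrift : ∀ x : X, ∫⁻ y, ENNReal.ofReal (W₀ y) ∂(P x) ≤
      ENNReal.ofReal (W₀ x - φ₀ (W₀ x) + C.indicator (fun _ => b₀) x))
    (SP : ℝ≥0∞) (hSP : SP = ⨆ x ∈ C, ∫⁻ y, ENNReal.ofReal (W₀ y) ∂(P x)) (hSPfin : SP ≠ ⊤)
    -- d₀ = inf_{x ∉ C} W₀(x) and the condition φ₀(d₀) > b₀
    (d₀ : ℝ) (hd₀ : d₀ = sInf (W₀ '' Cᶜ)) (hcond : b₀ < φ₀ d₀) :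
    ∀ lam : ℝ, 0 < lam → lam < 1 - b₀ / φ₀ d₀ →
      -- (A4) drift inequality off C×C, for the product coupling kernel
      (∀ x x' : X, (x, x') ∉ C ×ˢ C →
        ∫⁻ z : X × X, ENNReal.ofReal (W₀ z.1 + W₀ z.2 - 1) ∂((P x).prod (P x')) ≤
          ENNReal.ofReal ((W₀ x + W₀ x' - 1) - lam * φ₀ (W₀ x + W₀ x' - 1))) ∧
      -- bound for sup_{C×C} ǨW
      (∀ x x' : X, (x, x') ∈ C ×ˢ C →
        ∫⁻ z : X × X, ENNReal.ofReal (W₀ z.1 + W₀ z.2 - 1) ∂((Q x).prod (Q x')) ≤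
          2 * (ENNReal.ofReal (1 - ε))⁻¹ *
            (SP - ENNReal.ofReal ε * ∫⁻ y, ENNReal.ofReal (W₀ y) ∂ν) - 1) := by
  intro lam hl0 hl1
  constructor
  · intro x x' hx
    have hI := lint_aux (P x) (P x') W₀ hW₀meas hW₀1
    have o1 := (one_le_aux (P x) W₀ hW₀1).trans (hdrift x)
    have o2 := (one_le_aux (P x') W₀ hW₀1).trans (hdrift x')
    rw [ENNReal.one_le_ofReal] at o1 o2
    have hsum := add_le_add (hdrift x) (hdrift x')
    rw [← hI, ← ENNReal.ofReal_add (by linarith) (by linarith)] at hsum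
    have hu := hW₀1 x
    have hv := hW₀1 x'
    have hsub := hφ₀.sub_aux hu hv
    have hbdd : BddBelow (W₀ '' Cᶜ) := ⟨1, by rintro _ ⟨y, -, rfl⟩; exact hW₀1 y⟩
    have hge : ∀ y, y ∉ C → d₀ ≤ W₀ y ∧ 1 ≤ d₀ := fun y hy => by
      rw [hd₀]
      exact ⟨csInf_le hbdd ⟨y, hy, rfl⟩, le_csInf ⟨_, y, hy, rfl⟩
        (by rintro _ ⟨y, -, rfl⟩; exact hW₀1 y)⟩
    have hd : d₀ ≤ W₀ x + W₀ x' - 1 ∧ 1 ≤ d₀ := by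
      by_cases hxc : x ∈ C
      · have hx' : x' ∉ C := fun h => hx ⟨hxc, h⟩
        have := hge x' hx'
        exact ⟨by linarith, this.2⟩
      · have := hge x hxc
        exact ⟨by linarith, this.2⟩
    have hind : C.indicator (fun _ => b₀) x + C.indicator (fun _ => b₀) x' ≤ b₀ := by
      by_cases hxc : x ∈ C
      · have hx' : x' ∉ C := fun h => hx ⟨hxc, h⟩
        simp [hxc, hx']
      · by_cases hx' : x' ∈ C <;> simp [hxc, hx', hb₀]
    have hmono := hφ₀.mono_aux hd.2 hd.1
    have hpos : 0 < φ₀ d₀ := hφ₀.pos _ hd.2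
    have hkey : b₀ + lam * φ₀ (W₀ x + W₀ x' - 1) ≤ φ₀ (W₀ x + W₀ x' - 1) := by
      set s := φ₀ (W₀ x + W₀ x' - 1)
      have e : b₀ = b₀ / φ₀ d₀ * φ₀ d₀ := by field_simp
      have q : 0 ≤ b₀ / φ₀ d₀ := div_nonneg hb₀ hpos.le
      have g1 : b₀ ≤ b₀ / φ₀ d₀ * s := by
        calc b₀ = b₀ / φ₀ d₀ * φ₀ d₀ := e
          _ ≤ _ := mul_le_mul_of_nonneg_left hmono q
      have g2 : lam * s ≤ (1 - b₀ / φ₀ d₀) * s :=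
        mul_le_mul_of_nonneg_right hl1.le (hpos.le.trans hmono)
      linarith
    rw [← ENNReal.add_le_add_iff_right (a := 1) ENNReal.one_ne_top]
    refine hsum.trans ?_
    rw [← ENNReal.ofReal_one, ← ENNReal.ofReal_add (by linarith) zero_le_one]
    exact ENNReal.ofReal_le_ofReal (by linarith)
  · rintro x x' ⟨hx, hx'⟩
    have hI := lint_aux (Q x) (Q x') W₀ hW₀meas hW₀1
    have h0 : ENNReal.ofReal (1 - ε) ≠ 0 := by simpa using hε1
    have hb : ∀ y ∈ C, ∫⁻ z, ENNReal.ofReal (W₀ z) ∂(Q y) ≤ (ENNReal.ofReal (1 - ε))⁻¹ *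
            (SP - ENNReal.ofReal ε * ∫⁻ y, ENNReal.ofReal (W₀ y) ∂ν) := by
      intro y hy
      have hP : P y = ENNReal.ofReal ε • ν + ENNReal.ofReal (1 - ε) • Q y := by
        ext A hA
        simpa using hres y hy A hA
      have hle : ∫⁻ z, ENNReal.ofReal (W₀ z) ∂(P y) ≤ SP := by
        rw [hSP]
        exact le_iSup₂ (f := fun x (_ : x ∈ C) => ∫⁻ y, ENNReal.ofReal (W₀ y) ∂(P x)) y hy
      rw [hP, lintegral_add_measure, lintegral_smul_measure, lintegral_smul_measure,
        smul_eq_mul, smul_eq_mul] at hle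
      have hfin : ENNReal.ofReal ε * ∫⁻ y, ENNReal.ofReal (W₀ y) ∂ν ≠ ⊤ :=
        ne_top_of_le_ne_top hSPfin (le_self_add.trans hle)
      have h2 := ENNReal.le_sub_of_add_le_left hfin hle
      rw [mul_comm, ← div_eq_mul_inv, ENNReal.le_div_iff_mul_le (Or.inl h0)
        (Or.inl ENNReal.ofReal_ne_top), mul_comm]
      exact h2
    refine ENNReal.le_sub_of_add_le_right ENNReal.one_ne_top ?_
    rw [hI, mul_assoc, two_mul]
    exact add_le_add (hb x hx) (hb x' hx')
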